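/- Let λ > 0, p ∈ (0,1), q = 1 − p. Let B and S be nonnegative real-valued random variables with finite means, with Laplace–Stieltjes transforms β and σ respectively, let ρ = λE[B] < 1, assume E[S] > 0, and set E[C] = (1 − pρ)E[S]/(1 − ρ). Define, wherever the denominators are nonzero: M_a(z_a, z_b) = [σ(λ(1 − p z_a − q z_b)) − σ(qλ(1 − z_b))] / (λ E[C] (z_a − 1)); M_{bS}(z_b, z_v) = [β(λ(1 − z_v)) / (λE[C](z_b − β(λ(1 − z_v))))] · [σ(qλ(1 − z_b)) − σ(qλ(1 − β(λ(1 − z_v))))]; M_{bV}(z_v) = [β(λ(1 − z_v)) / (λE[C](z_v − β(λ(1 − z_v))))] · [σ(qλ(1 − β(λ(1 − z_v)))) − 1]. Then for every ω > 0 such that ω ≠ qλ(1 − β(ω)), ω ≠ λ(1 − β(ω)), and β(ω) ≠ 1, one has M_a(1 − ω/(pλ), 1) + M_{bS}(1 − ω/(qλ), 1 − ω/λ) + M_{bV}(1 − ω/λ) = [p(1−ρ)/(1−pρ)] · (1 − σ(ω))/(ω E[S]) + [q(1−ρ)/(1−pρ)] · [σ(ω) − σ(qλ(1 − β(ω)))]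 · β(ω) / [(qλ(1 − β(ω)) − ω) E[S]] + [(1−ρ)/(1−pρ)] · [σ(qλ(1 − β(ω))) − 1] · β(ω) / [(λ(1 − β(ω)) − ω) E[S]]. -/

import Mathlib

open MeasureTheory ProbabilityTheory Set
open scoped ProbabilityTheory

/-- The sojourn-time LST identity (equation (14) of the paper) for the M/G/1 vacation
queue with exhaustive service and synchronised reneging at the unique abandonment
epoch: `λ > 0` is the Poisson arrival rate, `B` the service time with LST `β`,
`S` the vacation with LST `σ`, `p ∈ (0,1)` the abandonment probability, `q = 1 - p`,
`ρ = λE[B] < 1`, and `E[C] = (1-pρ)E[S]/(1-ρ)` the mean cycle time.  With `Mₐ`,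
`M_{bS}`, `M_{bV}` the PGFs of the joint queue lengths at the departure epochs of the
three customer classes, one has, for `ω > 0` with `ω ≠ qλ(1-β(ω))`, `ω ≠ λ(1-β(ω))`
and `β(ω) ≠ 1`:
`Mₐ(1-ω/(pλ), 1) + M_{bS}(1-ω/(qλ), 1-ω/λ) + M_{bV}(1-ω/λ)` equals the closed-form
sojourn-time LST. -/
theorem sojourn_time_LST_vacation_reneging {Ω : Type*} [MeasureSpace Ω]
    [IsProbabilityMeasure (ℙ : Measure Ω)]
    (lam p q : ℝ) (hlam : 0 < lam) (hp : p ∈ Ioo (0:ℝ) 1) (hq : q = 1 - p)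
    (B S : Ω → ℝ) (hB : Measurable B) (hS : Measurable S)
    (hBnn : ∀ ω, 0 ≤ B ω) (hSnn : ∀ ω, 0 ≤ S ω)
    (hBint : Integrable B) (hSint : Integrable S)
    (β σ : ℝ → ℝ)
    (hβ : β = fun s => ∫ ω, Real.exp (-(s * B ω)))
    (hσ : σ = fun s => ∫ ω, Real.exp (-(s * S ω)))
    (ρ ES EC : ℝ) (hρ : ρ = lam * ∫ ω, B ω) (hρ1 : ρ < 1)
    (hES : ES = ∫ ω, S ω) (hES0 : 0 < ES)
    (hEC : EC = (1 - p * ρ) * ES / (1 - ρ))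
    (Ma : ℝ → ℝ → ℝ) (MbS : ℝ → ℝ → ℝ) (MbV : ℝ → ℝ)
    (hMa : Ma = fun za zb =>
      (σ (lam * (1 - p * za - q * zb)) - σ (q * lam * (1 - zb)))
        / (lam * EC * (za - 1)))
    (hMbS : MbS = fun zb zv =>
      β (lam * (1 - zv)) / (lam * EC * (zb - β (lam * (1 - zv))))
        * (σ (q * lam * (1 - zb)) - σ (q * lam * (1 - β (lam * (1 - zv))))))
    (hMbV : MbV = fun zv =>
      β (lam * (1 - zv)) / (lam * EC * (zv - β (lam * (1 - zv))))
        * (σ (q * lam * (1 - β (lam * (1 - zv)))) - 1))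
    (w : ℝ) (hw : 0 < w)
    (hw1 : w ≠ q * lam * (1 - β w)) (hw2 : w ≠ lam * (1 - β w)) (hw3 : β w ≠ 1) :
    Ma (1 - w / (p * lam)) 1 + MbS (1 - w / (q * lam)) (1 - w / lam)
        + MbV (1 - w / lam)
      = p * (1 - ρ) / (1 - p * ρ) * ((1 - σ w) / (w * ES))
        + q * (1 - ρ) / (1 - p * ρ)
            * (σ w - σ (q * lam * (1 - β w))) * β w
            / ((q * lam * (1 - β w) - w) * ES)
        + (1 - ρ) / (1 - p * ρ)
            * (σ (q * lam * (1 - β w)) - 1) * β w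
            / ((lam * (1 - β w) - w) * ES) := by
  obtain ⟨hp0, hp1⟩ := hp
  have hq0 : 0 < q := by linarith
  have hσ0 : σ 0 = 1 := by simp [hσ]
  have hρ' : 1 - ρ ≠ 0 := by linarith
  have hpρ : 1 - p * ρ ≠ 0 := by nlinarith [mul_pos hp0 (sub_pos.2 hρ1)]
  have hES' := hES0.ne'
  have hlam' := hlam.ne'
  have hp' := hp0.ne'
  have hq' := hq0.ne'
  have hw' := hw.ne'
  have hbS : q * lam * (1 - β w) - w ≠ 0 := sub_ne_zero.2 hw1.symm
  have hbV : lam * (1 - β w) - w ≠ 0 := sub_ne_zero.2 hw2.symm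
  have argMa : lam * (1 - p * (1 - w / (p * lam)) - q * 1) = w := by
    rw [hq]; field_simp; ring
  have argZv : lam * (1 - (1 - w / lam)) = w := by field_simp; ring
  have argZb : q * lam * (1 - (1 - w / (q * lam))) = w := by field_simp; ring
  have argOne : q * lam * (1 - 1) = 0 := by ring
  have denMa : lam * EC * (1 - w / (p * lam) - 1) = -(EC * w / p) := by
    field_simp; ring
  have denMbS : lam * EC * (1 - w / (q * lam) - β w)
      = EC * (q * lam * (1 - β w) - w) / q := by
    field_simp; ring
  have denMbV : lam * EC * (1 - w / lam - β w) = EC * (lam * (1 - β w) - w) := by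
    field_simp; ring
  simp only [hMa, hMbS, hMbV, argMa, argZv, argZb, argOne, denMa, denMbS, denMbV, hσ0]
  rw [hEC]
  generalize q * lam * (1 - β w) - w = x at hbS ⊢
  generalize lam * (1 - β w) - w = y at hbV ⊢
  field_simp
  ring
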